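/- (Rudin's extension theorem.) Let Φ : ℤ³ → ℂ. There exists a function Ψ : ℤ³ → ℂ that agrees with Φ on Δ(N₁,N₂,N₃) and is positive definite on ℤ³ (i.e., for every finitely supported ξ : ℤ³ → ℂ, the sum ∑_{p,p' ∈ ℤ³} ξ(p)·conj(ξ(p'))·Ψ(p − p') is a nonnegative real number) if and only if L_Φ(f) is a nonnegative real number for every f ∈ σ(N₁,N₂,N₃). -/

import Mathlib

open Complex ComplexOrder

noncomputable section

/-- The lattice box `Δ(N₁,N₂,N₃)`. -/
def Dbox (N₁ N₂ N₃ : ℕ) : Finset (ℤ × ℤ × ℤ) :=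
  Finset.Icc (-(N₁ : ℤ), -(N₂ : ℤ), -(N₃ : ℤ)) ((N₁ : ℤ), (N₂ : ℤ), (N₃ : ℤ))

/-- The character `exp(i(kα + ℓβ + mγ))`. -/
def eChar (δ : ℤ × ℤ × ℤ) (v : ℝ × ℝ × ℝ) : ℂ :=
  Complex.exp (Complex.I *
    ((δ.1 : ℂ) * (v.1 : ℂ) + (δ.2.1 : ℂ) * (v.2.1 : ℂ) + (δ.2.2 : ℂ) * (v.2.2 : ℂ)))

/-- `Ψ` is positive definite on all of `ℤ³`: for every finitely supported `ξ : ℤ³ → ℂ`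
(equivalently, every finite family of points), `∑ ξ(p) conj(ξ(p')) Ψ(p - p')` is a nonnegative
real number. -/
def PosDefZ3 (Ψ : ℤ × ℤ × ℤ → ℂ) : Prop :=
  ∀ (T : Finset (ℤ × ℤ × ℤ)) (ξ : ℤ × ℤ × ℤ → ℂ),
    0 ≤ ∑ p ∈ T, ∑ p' ∈ T, ξ p * (starRingEnd ℂ) (ξ p') * Ψ (p - p')

lemma eChar_add (a b : ℤ × ℤ × ℤ) (v : ℝ × ℝ × ℝ) : eChar (a + b) v = eChar a v * eChar b v := by
  simp only [eChar, ← Complex.exp_add]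
  congr 1
  simp only [Prod.fst_add, Prod.snd_add]
  push_cast
  ring

lemma eChar_neg (a : ℤ × ℤ × ℤ) (v : ℝ × ℝ × ℝ) :
    eChar (-a) v = (starRingEnd ℂ) (eChar a v) := by
  simp only [eChar, ← Complex.exp_conj]
  congr 1
  simp
  ring

lemma eChar_sub (a b : ℤ × ℤ × ℤ) (v : ℝ × ℝ × ℝ) :
    eChar (a - b) v = eChar a v * (starRingEnd ℂ) (eChar b v) := by
  rw [sub_eq_add_neg, eChar_add, eChar_neg]

lemma eChar_zero (v : ℝ × ℝ × ℝ) : eChar 0 v = 1 := by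
  simp [eChar]

lemma eChar_norm (a : ℤ × ℤ × ℤ) (v : ℝ × ℝ × ℝ) : ‖eChar a v‖ = 1 := by
  simp [eChar, Complex.norm_exp]

/-- Grid points. -/
def gridPt (M : ℕ) (j : ℕ × ℕ × ℕ) : ℝ × ℝ × ℝ :=
  (2 * Real.pi * j.1 / M, 2 * Real.pi * j.2.1 / M, 2 * Real.pi * j.2.2 / M)

/-- The cube of grid indices. -/
def gridIdx (M : ℕ) : Finset (ℕ × ℕ × ℕ) :=
  Finset.range M ×ˢ Finset.range M ×ˢ Finset.range M

lemma geom_orth (M : ℕ) (hM : 0 < M) (k : ℤ) (hk : |k| < M) :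
    ∑ j ∈ Finset.range M, (Complex.exp (2 * Real.pi * I / M) ^ k) ^ j
      = if k = 0 then (M : ℂ) else 0 := by
  have hp := Complex.isPrimitiveRoot_exp M hM.ne'
  split_ifs with h
  · simp [h]
  · have h1 : Complex.exp (2 * Real.pi * I / M) ^ k ≠ 1 := by
      intro h2
      rw [hp.zpow_eq_one_iff_dvd] at h2
      exact h (Int.eq_zero_of_abs_lt_dvd h2 hk)
    rw [geom_sum_eq h1]
    rw [← zpow_natCast, ← zpow_mul, mul_comm k, zpow_mul, zpow_natCast, hp.pow_eq_one]
    simp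

lemma eChar_grid (M : ℕ) (δ : ℤ × ℤ × ℤ) (j : ℕ × ℕ × ℕ) :
    eChar δ (gridPt M j) = (Complex.exp (2 * Real.pi * I / M) ^ δ.1) ^ j.1 *
      ((Complex.exp (2 * Real.pi * I / M) ^ δ.2.1) ^ j.2.1 *
      (Complex.exp (2 * Real.pi * I / M) ^ δ.2.2) ^ j.2.2) := by
  simp only [eChar, gridPt, ← Complex.exp_int_mul, ← Complex.exp_nat_mul, ← Complex.exp_add]
  congr 1
  push_cast
  ring

lemma grid_orth (M : ℕ) (hM : 0 < M) (δ : ℤ × ℤ × ℤ) (h1 : |δ.1| < M) (h2 : |δ.2.1| < M)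
    (h3 : |δ.2.2| < M) :
    ∑ j ∈ gridIdx M, eChar δ (gridPt M j) = if δ = 0 then (M : ℂ) ^ 3 else 0 := by
  simp only [eChar_grid, gridIdx, Finset.sum_product, ← Finset.mul_sum, ← Finset.sum_mul]
  rw [geom_orth M hM _ h1, geom_orth M hM _ h2, geom_orth M hM _ h3]
  obtain ⟨a, b, c⟩ := δ
  simp only [Prod.mk_eq_zero]
  by_cases ha : a = 0 <;> by_cases hb : b = 0 <;> by_cases hc : c = 0 <;> simp [ha, hb, hc]
  ring

/-- The cube `[0,n)^3`. -/
def cube (n : ℕ) : Finset (ℤ × ℤ × ℤ) :=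
  Finset.Ico 0 (n : ℤ) ×ˢ Finset.Ico 0 (n : ℤ) ×ˢ Finset.Ico 0 (n : ℤ)

lemma mem_Dbox (N₁ N₂ N₃ : ℕ) (δ : ℤ × ℤ × ℤ) :
    δ ∈ Dbox N₁ N₂ N₃ ↔ |δ.1| ≤ N₁ ∧ |δ.2.1| ≤ N₂ ∧ |δ.2.2| ≤ N₃ := by
  simp only [Dbox, Finset.mem_Icc, Prod.le_def, abs_le]
  tauto

lemma mem_cube (n : ℕ) (p : ℤ × ℤ × ℤ) :
    p ∈ cube n ↔ (0 ≤ p.1 ∧ p.1 < n) ∧ (0 ≤ p.2.1 ∧ p.2.1 < n) ∧ (0 ≤ p.2.2 ∧ p.2.2 < n) := by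
  simp [cube]

/-- Number of pairs in the cube with given difference. -/
def cnt (n : ℕ) (δ : ℤ × ℤ × ℤ) : ℕ := ((cube n).filter (fun p' => δ + p' ∈ cube n)).card

lemma cnt_eq (n : ℕ) (δ : ℤ × ℤ × ℤ) :
    cnt n δ = (n - δ.1.natAbs) * ((n - δ.2.1.natAbs) * (n - δ.2.2.natAbs)) := by
  have : (cube n).filter (fun p' => δ + p' ∈ cube n) =
      Finset.Ico (max 0 (-δ.1)) (min n (n - δ.1)) ×ˢ
      Finset.Ico (max 0 (-δ.2.1)) (min n (n - δ.2.1)) ×ˢ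
      Finset.Ico (max 0 (-δ.2.2)) (min n (n - δ.2.2)) := by
    ext p
    simp only [Finset.mem_filter, mem_cube, Finset.mem_product, Finset.mem_Ico, Prod.fst_add,
      Prod.snd_add]
    omega
  rw [cnt, this]
  simp only [Finset.card_product, Int.card_Ico]
  congr 1
  · omega
  · congr 1 <;> omega

lemma tendsto_one_dim (d : ℕ) :
    Filter.Tendsto (fun n : ℕ => (((n - d : ℕ) : ℝ) / n)) Filter.atTop (nhds 1) := by
  have h : Filter.Tendsto (fun n : ℕ => (1 : ℝ) - (d : ℝ) / n) Filter.atTop (nhds (1 - 0)) :=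
    tendsto_const_nhds.sub (tendsto_const_div_atTop_nhds_zero_nat _)
  rw [sub_zero] at h
  refine h.congr' ?_
  filter_upwards [Filter.eventually_ge_atTop (d + 1)] with n hn
  have : (n : ℝ) ≠ 0 := by
    have : n ≠ 0 := by omega
    exact_mod_cast this
  rw [Nat.cast_sub (by omega)]
  field_simp

lemma cnt_tendsto (δ : ℤ × ℤ × ℤ) :
    Filter.Tendsto (fun n : ℕ => (((cnt n δ : ℝ) / n ^ 3 : ℝ) : ℂ)) Filter.atTop (nhds 1) := by
  have := (tendsto_one_dim δ.1.natAbs).mul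
    ((tendsto_one_dim δ.2.1.natAbs).mul (tendsto_one_dim δ.2.2.natAbs))
  rw [mul_one, mul_one] at this
  have h2 := (Complex.continuous_ofReal.tendsto 1).comp this
  rw [Complex.ofReal_one] at h2
  refine h2.congr ?_
  intro n
  simp only [Function.comp, cnt_eq]
  congr 1
  push_cast
  rw [div_mul_div_comm, div_mul_div_comm]
  congr 1
  ring

lemma sum_pairs (n : ℕ) (F : ℤ × ℤ × ℤ → ℂ) (δ : ℤ × ℤ × ℤ) :
    ∑ p ∈ cube n, ∑ p' ∈ cube n, (if δ + (p' - p) = 0 then F δ else 0) = cnt n δ * F δ := by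
  rw [Finset.sum_comm]
  have : ∀ p' ∈ cube n, ∑ p ∈ cube n, (if δ + (p' - p) = 0 then F δ else 0) =
      if δ + p' ∈ cube n then F δ else 0 := by
    intro p' _
    have : ∀ p, (δ + (p' - p) = 0) ↔ (δ + p' = p) := by
      intro p
      rw [← add_sub_assoc, sub_eq_zero]
    simp only [this]
    rw [Finset.sum_ite_eq]
  rw [Finset.sum_congr rfl this, ← Finset.sum_filter, Finset.sum_const, nsmul_eq_mul]
  rfl

lemma finite_nonneg (N₁ N₂ N₃ : ℕ) (Ψ : ℤ × ℤ × ℤ → ℂ) (hΨ : PosDefZ3 Ψ) (q : ℤ × ℤ × ℤ → ℂ)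
    (hq : ∀ v : ℝ × ℝ × ℝ, 0 ≤ ∑ δ ∈ Dbox N₁ N₂ N₃, q δ * eChar δ v) (n : ℕ) :
    0 ≤ ∑ δ ∈ Dbox N₁ N₂ N₃, (cnt n δ : ℂ) * (q δ * Ψ δ) := by
  set M : ℕ := N₁ + N₂ + N₃ + n + 1 with hMdef
  have hM : 0 < M := by omega
  have key : 0 ≤ ∑ j ∈ gridIdx M, (∑ δ ∈ Dbox N₁ N₂ N₃, q δ * eChar δ (gridPt M j)) *
      (∑ p ∈ cube n, ∑ p' ∈ cube n, (starRingEnd ℂ) (eChar p (gridPt M j)) *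
        (starRingEnd ℂ) ((starRingEnd ℂ) (eChar p' (gridPt M j))) * Ψ (p - p')) := by
    refine Finset.sum_nonneg fun j _ => mul_nonneg (hq _) ?_
    exact hΨ (cube n) (fun p => (starRingEnd ℂ) (eChar p (gridPt M j)))
  have h2 : ∑ j ∈ gridIdx M, (∑ δ ∈ Dbox N₁ N₂ N₃, q δ * eChar δ (gridPt M j)) *
      (∑ p ∈ cube n, ∑ p' ∈ cube n, (starRingEnd ℂ) (eChar p (gridPt M j)) *
        (starRingEnd ℂ) ((starRingEnd ℂ) (eChar p' (gridPt M j))) * Ψ (p - p')) =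
      ∑ δ ∈ Dbox N₁ N₂ N₃, ∑ p ∈ cube n, ∑ p' ∈ cube n, q δ * Ψ (p - p') *
        ∑ j ∈ gridIdx M, eChar (δ + (p' - p)) (gridPt M j) := by
    simp only [Finset.sum_mul]
    simp only [Finset.mul_sum]
    rw [Finset.sum_comm]
    refine Finset.sum_congr rfl fun δ _ => ?_
    rw [Finset.sum_comm]
    refine Finset.sum_congr rfl fun p _ => ?_
    rw [Finset.sum_comm]
    refine Finset.sum_congr rfl fun p' _ => ?_
    refine Finset.sum_congr rfl fun j _ => ?_
    rw [eChar_add, eChar_sub, Complex.conj_conj]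
    ring
  have h3 : ∀ δ ∈ Dbox N₁ N₂ N₃, ∑ p ∈ cube n, ∑ p' ∈ cube n, q δ * Ψ (p - p') *
        ∑ j ∈ gridIdx M, eChar (δ + (p' - p)) (gridPt M j) =
        (M : ℂ) ^ 3 * ((cnt n δ : ℂ) * (q δ * Ψ δ)) := by
    intro δ hδ
    rw [← sum_pairs n (fun δ => q δ * Ψ δ) δ, Finset.mul_sum]
    refine Finset.sum_congr rfl fun p hp => ?_
    rw [Finset.mul_sum]
    refine Finset.sum_congr rfl fun p' hp' => ?_
    rw [mem_Dbox] at hδ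
    rw [mem_cube] at hp hp'
    simp only [abs_le] at hδ
    rw [grid_orth M hM]
    · split_ifs with h
      · have : p - p' = δ := by
          rw [← sub_eq_zero, ← neg_eq_zero, ← h]; abel
        rw [this]; ring
      · simp
    all_goals
      simp only [abs_lt, Prod.fst_add, Prod.snd_add, Prod.fst_sub, Prod.snd_sub]
      omega
  rw [h2, Finset.sum_congr rfl h3, ← Finset.mul_sum] at key
  have hM' : (0 : ℂ) < ((M : ℝ) ^ 3 : ℝ) := by
    rw [Complex.zero_lt_real]; positivity
  push_cast at hM'
  have hMi : (0 : ℂ) ≤ (((M : ℝ) ^ 3)⁻¹ : ℝ) := by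
    rw [Complex.zero_le_real]; positivity
  have := mul_nonneg hMi key
  push_cast at this
  rwa [inv_mul_cancel_left₀ hM'.ne'] at this

lemma forward (N₁ N₂ N₃ : ℕ) (Ψ : ℤ × ℤ × ℤ → ℂ) (hΨ : PosDefZ3 Ψ) (q : ℤ × ℤ × ℤ → ℂ)
    (hq : ∀ v : ℝ × ℝ × ℝ, 0 ≤ ∑ δ ∈ Dbox N₁ N₂ N₃, q δ * eChar δ v) :
    0 ≤ ∑ δ ∈ Dbox N₁ N₂ N₃, q δ * Ψ δ := by
  have ht : Filter.Tendsto (fun n : ℕ => ∑ δ ∈ Dbox N₁ N₂ N₃,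
      (((cnt n δ : ℝ) / n ^ 3 : ℝ) : ℂ) * (q δ * Ψ δ)) Filter.atTop
      (nhds (∑ δ ∈ Dbox N₁ N₂ N₃, 1 * (q δ * Ψ δ))) :=
    tendsto_finsetSum _ fun δ _ => (cnt_tendsto δ).mul_const _
  simp only [one_mul] at ht
  refine ge_of_tendsto' ht fun n => ?_
  have h := finite_nonneg N₁ N₂ N₃ Ψ hΨ q hq n
  have h0 : (0 : ℂ) ≤ (((n : ℝ) ^ 3)⁻¹ : ℝ) := by
    rw [Complex.zero_le_real]; positivity
  have := mul_nonneg h0 h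
  rw [Finset.mul_sum] at this
  refine this.trans_eq (Finset.sum_congr rfl fun δ _ => ?_)
  push_cast
  ring

lemma poly_norm_le (S : Finset (ℤ × ℤ × ℤ)) (q : ℤ × ℤ × ℤ → ℂ) (v : ℝ × ℝ × ℝ) :
    ‖∑ δ ∈ S, q δ * eChar δ v‖ ≤ ∑ δ ∈ S, ‖q δ‖ := by
  refine (norm_sum_le _ _).trans (Finset.sum_le_sum fun δ _ => ?_)
  simp [eChar_norm]

lemma zero_mem_Dbox (N₁ N₂ N₃ : ℕ) : (0 : ℤ × ℤ × ℤ) ∈ Dbox N₁ N₂ N₃ := by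
  simp [mem_Dbox]

lemma Dbox_sum_neg (N₁ N₂ N₃ : ℕ) (F : ℤ × ℤ × ℤ → ℂ) :
    ∑ δ ∈ Dbox N₁ N₂ N₃, F (-δ) = ∑ δ ∈ Dbox N₁ N₂ N₃, F δ := by
  refine Finset.sum_nbij' (fun δ => -δ) (fun δ => -δ) ?_ ?_ ?_ ?_ ?_
  all_goals simp [mem_Dbox]

/-- If the polynomial is real valued then the functional is real. -/
lemma L_real (N₁ N₂ N₃ : ℕ) (Φ : ℤ × ℤ × ℤ → ℂ)
    (H : ∀ q : ℤ × ℤ × ℤ → ℂ,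
        (∀ v : ℝ × ℝ × ℝ, 0 ≤ ∑ δ ∈ Dbox N₁ N₂ N₃, q δ * eChar δ v) →
        0 ≤ ∑ δ ∈ Dbox N₁ N₂ N₃, q δ * Φ δ) (q : ℤ × ℤ × ℤ → ℂ)
    (hq : ∀ v : ℝ × ℝ × ℝ, (∑ δ ∈ Dbox N₁ N₂ N₃, q δ * eChar δ v).im = 0) :
    (∑ δ ∈ Dbox N₁ N₂ N₃, q δ * Φ δ).im = 0 := by
  have z := zero_mem_Dbox N₁ N₂ N₃
  set C : ℝ := ∑ δ ∈ Dbox N₁ N₂ N₃, ‖q δ‖ with hC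
  have hC0 : 0 ≤ C := Finset.sum_nonneg fun _ _ => norm_nonneg _
  have h1 := H (fun δ => if δ = 0 then (C : ℂ) else 0) (by
    intro v
    simp [ite_mul, Finset.sum_ite_eq', z, eChar_zero, hC0])
  have h2 := H (fun δ => q δ + if δ = 0 then (C : ℂ) else 0) (by
    intro v
    simp only [add_mul, Finset.sum_add_distrib, ite_mul, zero_mul, Finset.sum_ite_eq', z, if_true,
      eChar_zero, mul_one]
    rw [Complex.nonneg_iff]
    have h3 := (abs_le.1 ((Complex.abs_re_le_norm _).trans (poly_norm_le (Dbox N₁ N₂ N₃) q v))).1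
    constructor
    · rw [Complex.add_re, Complex.ofReal_re]; linarith
    · rw [Complex.add_im, Complex.ofReal_im, hq v, add_zero])
  simp only [add_mul, Finset.sum_add_distrib] at h2
  rw [Complex.nonneg_iff] at h1 h2
  have := h2.2
  rw [Complex.add_im, ← h1.2] at this
  linarith

lemma L_re_nonneg (N₁ N₂ N₃ : ℕ) (Φ : ℤ × ℤ × ℤ → ℂ)
    (H : ∀ q : ℤ × ℤ × ℤ → ℂ,
        (∀ v : ℝ × ℝ × ℝ, 0 ≤ ∑ δ ∈ Dbox N₁ N₂ N₃, q δ * eChar δ v) →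
        0 ≤ ∑ δ ∈ Dbox N₁ N₂ N₃, q δ * Φ δ) (q : ℤ × ℤ × ℤ → ℂ)
    (hq : ∀ v : ℝ × ℝ × ℝ, 0 ≤ (∑ δ ∈ Dbox N₁ N₂ N₃, q δ * eChar δ v).re) :
    0 ≤ (∑ δ ∈ Dbox N₁ N₂ N₃, q δ * Φ δ).re := by
  have hs : ∀ v, ∑ δ ∈ Dbox N₁ N₂ N₃, (starRingEnd ℂ) (q (-δ)) * eChar δ v =
      (starRingEnd ℂ) (∑ δ ∈ Dbox N₁ N₂ N₃, q δ * eChar δ v) := by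
    intro v
    rw [← Dbox_sum_neg, map_sum]
    refine Finset.sum_congr rfl fun δ _ => ?_
    rw [neg_neg, map_mul, eChar_neg]
  have h1 := H (fun δ => q δ + (starRingEnd ℂ) (q (-δ))) (by
    intro v
    simp only [add_mul, Finset.sum_add_distrib]
    rw [hs, Complex.add_conj, Complex.zero_le_real]
    linarith [hq v])
  have h2 := L_real N₁ N₂ N₃ Φ H (fun δ => I * (q δ - (starRingEnd ℂ) (q (-δ)))) (by
    intro v
    simp only [mul_assoc, ← Finset.mul_sum]
    simp only [sub_mul, Finset.sum_sub_distrib]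
    rw [hs]
    simp)
  simp only [mul_assoc, ← Finset.mul_sum] at h2
  simp only [sub_mul, add_mul, Finset.sum_add_distrib, Finset.sum_sub_distrib] at h1 h2
  rw [Complex.nonneg_iff] at h1
  have h3 := h1.1
  simp only [Complex.mul_im, Complex.I_re, Complex.I_im, zero_mul, one_mul, zero_add,
    Complex.sub_re, Complex.add_re] at h2 h3
  linarith

/-- The linear pairing `q ↦ ∑ q(δ) c(δ)`. -/
def pair (c : ℤ × ℤ × ℤ → ℂ) : ((ℤ × ℤ × ℤ) →₀ ℂ) →ₗ[ℂ] ℂ :=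
  Finsupp.linearCombination ℂ c

lemma pair_single (c : ℤ × ℤ × ℤ → ℂ) (δ : ℤ × ℤ × ℤ) (a : ℂ) :
    pair c (Finsupp.single δ a) = a * c δ := by
  simp [pair]

lemma pair_eq (c : ℤ × ℤ × ℤ → ℂ) (S : Finset (ℤ × ℤ × ℤ)) (q : (ℤ × ℤ × ℤ) →₀ ℂ)
    (h : q.support ⊆ S) : pair c q = ∑ δ ∈ S, q δ * c δ := by
  rw [pair, Finsupp.linearCombination_apply, Finsupp.sum_of_support_subset _ h _ (by simp)]
  rfl

/-- real part of the pairing, as a real linear map -/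
def rePair (c : ℤ × ℤ × ℤ → ℂ) : ((ℤ × ℤ × ℤ) →₀ ℂ) →ₗ[ℝ] ℝ :=
  Complex.reLm.comp ((pair c).restrictScalars ℝ)

lemma rePair_apply (c : ℤ × ℤ × ℤ → ℂ) (q : (ℤ × ℤ × ℤ) →₀ ℂ) :
    rePair c q = (pair c q).re := rfl

/-- The cone of coefficient families whose polynomial has nonnegative real part. -/
def posCone : PointedCone ℝ ((ℤ × ℤ × ℤ) →₀ ℂ) where
  carrier := {q | ∀ v, 0 ≤ rePair (fun δ => eChar δ v) q}
  smul_mem' := by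
    intro c x hx v
    change 0 ≤ rePair _ ((c : ℝ) • x)
    rw [map_smul]
    exact mul_nonneg c.2 (hx v)
  zero_mem' := by
    intro v
    rw [map_zero]
  add_mem' := by
    intro x y hx hy v
    rw [map_add]
    exact add_nonneg (hx v) (hy v)

lemma mem_posCone (q : (ℤ × ℤ × ℤ) →₀ ℂ) :
    q ∈ posCone ↔ ∀ v, 0 ≤ rePair (fun δ => eChar δ v) q := Iff.rfl

lemma exists_ext (N₁ N₂ N₃ : ℕ) (Φ : ℤ × ℤ × ℤ → ℂ)
    (H : ∀ q : ℤ × ℤ × ℤ → ℂ,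
        (∀ v : ℝ × ℝ × ℝ, 0 ≤ ∑ δ ∈ Dbox N₁ N₂ N₃, q δ * eChar δ v) →
        0 ≤ ∑ δ ∈ Dbox N₁ N₂ N₃, q δ * Φ δ) :
    ∃ g : ((ℤ × ℤ × ℤ) →₀ ℂ) →ₗ[ℝ] ℝ,
      (∀ δ ∈ Dbox N₁ N₂ N₃, ∀ a, g (Finsupp.single δ a) = (a * Φ δ).re) ∧
      ∀ q ∈ posCone, 0 ≤ g q := by
  let W : Submodule ℝ ((ℤ × ℤ × ℤ) →₀ ℂ) := Finsupp.supported ℂ ℝ (Dbox N₁ N₂ N₃ : Set _)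
  have hW : ∀ δ ∈ Dbox N₁ N₂ N₃, ∀ a : ℂ, Finsupp.single δ a ∈ W := fun δ hδ a =>
    Finsupp.single_mem_supported ℝ a hδ
  obtain ⟨g, hg1, hg2⟩ := riesz_extension posCone ⟨W, (rePair Φ).comp W.subtype⟩ (by
    rintro ⟨q, hq⟩ hpos
    have hsupp : q.support ⊆ Dbox N₁ N₂ N₃ := by
      have := (Finsupp.mem_supported ℝ q).1 hq
      exact_mod_cast this
    change 0 ≤ rePair Φ q
    rw [rePair_apply, pair_eq _ _ _ hsupp]
    refine L_re_nonneg N₁ N₂ N₃ Φ H _ fun v => ?_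
    have := hpos v
    rwa [rePair_apply, pair_eq _ _ _ hsupp] at this) (by
    intro y
    refine ⟨⟨Finsupp.single 0 ((∑ δ ∈ y.support, ‖y δ‖ : ℝ) : ℂ),
      hW 0 (zero_mem_Dbox _ _ _) _⟩, ?_⟩
    intro v
    rw [map_add, rePair_apply, rePair_apply, pair_single, eChar_zero, mul_one, Complex.ofReal_re,
      pair_eq _ _ y subset_rfl]
    have h3 := (abs_le.1 ((Complex.abs_re_le_norm _).trans (poly_norm_le y.support y v))).1
    linarith)
  refine ⟨g, fun δ hδ a => ?_, hg2⟩
  have := hg1 ⟨Finsupp.single δ a, hW δ hδ a⟩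
  rw [this]
  change rePair Φ (Finsupp.single δ a) = _
  rw [rePair_apply, pair_single]

lemma g_eq (g : ((ℤ × ℤ × ℤ) →₀ ℂ) →ₗ[ℝ] ℝ) (q : (ℤ × ℤ × ℤ) →₀ ℂ) :
    g q = rePair (fun δ => (⟨g (Finsupp.single δ 1), -g (Finsupp.single δ I)⟩ : ℂ)) q := by
  induction q using Finsupp.induction_linear with
  | zero => simp
  | add f h hf hh => rw [map_add, map_add, hf, hh]
  | single δ a =>
    rw [rePair_apply, pair_single]
    have : Finsupp.single δ a = a.re • Finsupp.single δ (1 : ℂ) + a.im • Finsupp.single δ I := by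
      rw [Finsupp.smul_single, Finsupp.smul_single, ← Finsupp.single_add]
      congr 1
      apply Complex.ext <;> simp
    rw [this, map_add, map_smul, map_smul]
    simp

lemma backward (N₁ N₂ N₃ : ℕ) (Φ : ℤ × ℤ × ℤ → ℂ)
    (H : ∀ q : ℤ × ℤ × ℤ → ℂ,
        (∀ v : ℝ × ℝ × ℝ, 0 ≤ ∑ δ ∈ Dbox N₁ N₂ N₃, q δ * eChar δ v) →
        0 ≤ ∑ δ ∈ Dbox N₁ N₂ N₃, q δ * Φ δ) :
    ∃ Ψ : ℤ × ℤ × ℤ → ℂ, (∀ δ ∈ Dbox N₁ N₂ N₃, Ψ δ = Φ δ) ∧ PosDefZ3 Ψ := by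
  obtain ⟨g, hg1, hg2⟩ := exists_ext N₁ N₂ N₃ Φ H
  have hge := g_eq g
  set Ψ : ℤ × ℤ × ℤ → ℂ := fun δ => ⟨g (Finsupp.single δ 1), -g (Finsupp.single δ I)⟩ with hΨ
  refine ⟨Ψ, ?_, ?_⟩
  · intro δ hδ
    apply Complex.ext <;> simp [hΨ, hg1 δ hδ]
  · intro T ξ
    let q : (ℤ × ℤ × ℤ) →₀ ℂ :=
      ∑ p ∈ T, ∑ p' ∈ T, Finsupp.single (p - p') (ξ p * (starRingEnd ℂ) (ξ p'))
    have hq : ∀ c, pair c q = ∑ p ∈ T, ∑ p' ∈ T, ξ p * (starRingEnd ℂ) (ξ p') * c (p - p') := by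
      intro c
      simp only [q, map_sum, pair_single]
    have hpol : ∀ v, pair (fun δ => eChar δ v) q =
        ((Complex.normSq (∑ p ∈ T, ξ p * eChar p v) : ℝ) : ℂ) := by
      intro v
      rw [hq, ← Complex.mul_conj, map_sum, Finset.sum_mul_sum]
      refine Finset.sum_congr rfl fun p _ => Finset.sum_congr rfl fun p' _ => ?_
      rw [eChar_sub, map_mul]
      ring
    rw [← hq, Complex.nonneg_iff]
    have h1 : 0 ≤ g q := hg2 q fun v => by
      rw [rePair_apply, hpol, Complex.ofReal_re]
      exact Complex.normSq_nonneg _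
    have h2 : 0 ≤ g (I • q) := hg2 _ fun v => by
      rw [rePair_apply, map_smul, hpol]
      simp
    have h3 : 0 ≤ g ((-I) • q) := hg2 _ fun v => by
      rw [rePair_apply, map_smul, hpol]
      simp
    rw [hge, rePair_apply] at h1
    rw [hge, rePair_apply, map_smul] at h2 h3
    refine ⟨h1, ?_⟩
    simp only [smul_eq_mul, Complex.mul_re, Complex.neg_re, Complex.neg_im, Complex.I_re,
      Complex.I_im] at h2 h3
    linarith

/-- Proposition 4 (Rudin's extension theorem): `Φ` extends from `Δ(N₁,N₂,N₃)` to a positive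
definite function on `ℤ³` iff `L_Φ(f) = ∑_{δ ∈ Δ} q(δ) Φ(δ)` is a nonnegative real number for
every nonnegative trigonometric polynomial `f = ∑_{δ ∈ Δ} q(δ) e^{iδ·v} ∈ σ(N₁,N₂,N₃)`. -/
theorem rudin_extension (N₁ N₂ N₃ : ℕ) (Φ : ℤ × ℤ × ℤ → ℂ) :
    (∃ Ψ : ℤ × ℤ × ℤ → ℂ, (∀ δ ∈ Dbox N₁ N₂ N₃, Ψ δ = Φ δ) ∧ PosDefZ3 Ψ) ↔
      (∀ q : ℤ × ℤ × ℤ → ℂ,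
        (∀ v : ℝ × ℝ × ℝ, 0 ≤ ∑ δ ∈ Dbox N₁ N₂ N₃, q δ * eChar δ v) →
        0 ≤ ∑ δ ∈ Dbox N₁ N₂ N₃, q δ * Φ δ) := by
  constructor
  · rintro ⟨Ψ, hag, hpd⟩ q hq
    have h := forward N₁ N₂ N₃ Ψ hpd q hq
    rwa [Finset.sum_congr rfl fun δ hδ => by rw [hag δ hδ]] at h
  · exact backward N₁ N₂ N₃ Φ
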